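/- arXiv:1907.09244 — 4 statements merged into one kernel-verified Lean document; each statement's English description precedes it below -/
import Mathlib

section
/- Let V and W be sets, M ≥ 0, and F : ℝ × W → ℝ. Assume that for every w ∈ W there exists a_w ∈ ℝ such that the map u ↦ F(u, w) is non-increasing on (−∞, a_w], non-decreasing on [a_w, ∞), and M-Lipschitz on ℝ. Let l, a, u : V → ℝ satisfy l(v) ≤ a(v) ≤ u(v) for all v ∈ V. Define Λ(v,w) = F(a_w, w) if l(v) ≤ a_w ≤ u(v), and Λ(v,w) = min(F(l(v), w), F(u(v), w)) otherwise; and define Γ(v,w) = max(F(l(v), w), F(u(v), w)). Then for every (v,w) ∈ V × W: (i) Λ(v,w) ≤ F(a(v), w) ≤ Γ(v,w), and (ii) Γ(v,w) − Λ(v,w) ≤ M · (u(v) − l(v)). -/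
/-- Pointwise bracket construction: if `F(·, w)` is non-increasing on `(-∞, a_w]`,
non-decreasing on `[a_w, ∞)`, and `M`-Lipschitz, and `l ≤ a ≤ u`, then the bracket
`[Λ, Γ]` defined below contains `F(a(·), ·)` and has width at most `M·(u - l)`. -/
theorem stmt_2 {V W : Type*} (M : ℝ) (hM : 0 ≤ M) (F : ℝ → W → ℝ) (aw : W → ℝ)
    (hanti : ∀ w : W, AntitoneOn (fun x => F x w) (Set.Iic (aw w)))
    (hmono : ∀ w : W, MonotoneOn (fun x => F x w) (Set.Ici (aw w)))
    (hlip : ∀ w : W, ∀ x₁ x₂ : ℝ, |F x₁ w - F x₂ w| ≤ M * |x₁ - x₂|)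
    (l a u : V → ℝ) (hla : ∀ v : V, l v ≤ a v) (hau : ∀ v : V, a v ≤ u v)
    (v : V) (w : W) :
    ((if l v ≤ aw w ∧ aw w ≤ u v then F (aw w) w else min (F (l v) w) (F (u v) w))
        ≤ F (a v) w ∧
      F (a v) w ≤ max (F (l v) w) (F (u v) w)) ∧
    max (F (l v) w) (F (u v) w) -
        (if l v ≤ aw w ∧ aw w ≤ u v then F (aw w) w else min (F (l v) w) (F (u v) w))
      ≤ M * (u v - l v) := by
  have anti : ∀ x y, x ≤ y → y ≤ aw w → F y w ≤ F x w := fun x y hxy hy =>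
    hanti w (Set.mem_Iic.2 (hxy.trans hy)) (Set.mem_Iic.2 hy) hxy
  have mono : ∀ x y, aw w ≤ x → x ≤ y → F x w ≤ F y w := fun x y hx hxy =>
    hmono w (Set.mem_Ici.2 hx) (Set.mem_Ici.2 (hx.trans hxy)) hxy
  have lip : ∀ x y, |F x w - F y w| ≤ M * |x - y| := hlip w
  have hl := hla v
  have hu := hau v
  have upper : F (a v) w ≤ max (F (l v) w) (F (u v) w) := by
    rcases le_total (a v) (aw w) with h | h
    · exact le_max_of_le_left (anti _ _ hl h)
    · exact le_max_of_le_right (mono _ _ h hu)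
  split_ifs with hc
  · obtain ⟨hlc, hcu⟩ := hc
    refine ⟨⟨?_, upper⟩, ?_⟩
    · rcases le_total (a v) (aw w) with h | h
      · exact anti _ _ h le_rfl
      · exact mono _ _ le_rfl h
    · rw [sub_le_iff_le_add]
      apply max_le
      · have h := (le_abs_self _).trans (lip (l v) (aw w))
        rw [abs_sub_comm, abs_of_nonneg (sub_nonneg.2 hlc)] at h
        have := mul_le_mul_of_nonneg_left (sub_le_sub_right hcu (l v)) hM
        linarith
      · have h := (le_abs_self _).trans (lip (u v) (aw w))
        rw [abs_of_nonneg (sub_nonneg.2 hcu)] at h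
        have := mul_le_mul_of_nonneg_left (sub_le_sub_left hlc (u v)) hM
        linarith
  · refine ⟨⟨?_, upper⟩, ?_⟩
    · rcases lt_or_ge (aw w) (l v) with h | h
      · exact min_le_of_left_le (mono _ _ h.le hl)
      · have hcu : u v < aw w := not_le.1 fun h' => hc ⟨h, h'⟩
        exact min_le_of_right_le (anti _ _ hu hcu.le)
    · have h := lip (u v) (l v)
      rwa [abs_of_nonneg (sub_nonneg.2 (hl.trans hu)), abs_sub_comm,
        ← max_sub_min_eq_abs'] at h
end

section
/- Let p ∈ [0, 1], a > 0, and define f_p(q) = p·log(1 + e^{−q}) + (1 − p)·log(1 + e^{q}). Then for all q₁, q₂ ∈ [−a, a], f_p(q₁) − f_p(q₂) ≥ (1/(1 + e^{−q₂}) − p)·(q₁ − q₂) + (1/(4(1 + e^{a})))·(q₁ − q₂)². -/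
theorem ConvexOn.add_mul_sub_le_of_hasDerivAt {s : Set ℝ} {f : ℝ → ℝ} {f' x y : ℝ}
    (hf : ConvexOn ℝ s f) (hx : x ∈ s) (hy : y ∈ s) (hd : HasDerivAt f f' x) :
    f x + f' * (y - x) ≤ f y := by
  rcases lt_trichotomy x y with h | rfl | h
  · have := hf.le_slope_of_hasDerivAt hx hy h hd
    rw [slope_def_field, le_div_iff₀ (sub_pos.2 h)] at this
    linarith
  · simp
  · have := hf.slope_le_of_hasDerivAt hy hx h hd
    rw [slope_def_field, div_le_iff₀ (sub_pos.2 h)] at this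
    linarith

theorem hasDerivAt_log_one_add_exp (x : ℝ) :
    HasDerivAt (fun x => Real.log (1 + Real.exp x)) (1 / (1 + Real.exp (-x))) x := by
  convert ((Real.hasDerivAt_exp x).const_add 1).log (by positivity) using 1
  rw [Real.exp_neg]
  field_simp
  ring

theorem hasDerivAt_one_div_one_add_exp_neg (x : ℝ) :
    HasDerivAt (fun x => 1 / (1 + Real.exp (-x))) (Real.exp x / (1 + Real.exp x) ^ 2) x := by
  have h := (((hasDerivAt_neg x).exp).const_add 1).fun_inv (by positivity)
  simp only [one_div]
  refine h.congr_deriv ?_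
  rw [Real.exp_neg]
  field_simp
  ring

theorem log_one_add_exp_neg (x : ℝ) :
    Real.log (1 + Real.exp (-x)) = Real.log (1 + Real.exp x) - x := by
  have h : 1 + Real.exp (-x) = (1 + Real.exp x) / Real.exp x := by
    rw [Real.exp_neg]
    field_simp
    ring
  rw [h, Real.log_div (by positivity) (by positivity), Real.log_exp]

theorem one_div_le_exp_div_one_add_exp_sq {a x : ℝ} (hx : x ∈ Set.Icc (-a) a) :
    1 / (2 * (1 + Real.exp a)) ≤ Real.exp x / (1 + Real.exp x) ^ 2 := by
  have h₁ : Real.exp x ≤ Real.exp a := Real.exp_le_exp.2 hx.2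
  have h₂ : 1 ≤ Real.exp a * Real.exp x := by
    rw [← Real.exp_add]
    exact Real.one_le_exp (by linarith [hx.1])
  have h₃ := Real.exp_pos x
  rw [div_le_div_iff₀ (by positivity) (by positivity)]
  nlinarith [mul_le_mul_of_nonneg_right h₁ h₃.le]

theorem convexOn_log_one_add_exp_sub_sq (a : ℝ) :
    ConvexOn ℝ (Set.Icc (-a) a)
      fun x => Real.log (1 + Real.exp x) - 1 / (4 * (1 + Real.exp a)) * x ^ 2 := by
  refine convexOn_of_hasDerivWithinAt2_nonneg (convex_Icc _ _)
    (f' := fun x => 1 / (1 + Real.exp (-x)) - 1 / (2 * (1 + Real.exp a)) * x)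
    (f'' := fun x => Real.exp x / (1 + Real.exp x) ^ 2 - 1 / (2 * (1 + Real.exp a)))
    ?_ (fun x _ => ?_) (fun x _ => ?_) (fun x hx => ?_)
  · exact fun x _ => ((hasDerivAt_log_one_add_exp x).continuousAt.sub
      (by fun_prop)).continuousWithinAt
  · refine HasDerivAt.hasDerivWithinAt ?_
    refine ((hasDerivAt_log_one_add_exp x).fun_sub
      ((hasDerivAt_pow 2 x).const_mul (1 / (4 * (1 + Real.exp a))))).congr_deriv ?_
    norm_num
    field_simp
    ring
  · refine HasDerivAt.hasDerivWithinAt ?_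
    simpa using (hasDerivAt_one_div_one_add_exp_neg x).fun_sub
      ((hasDerivAt_id x).const_mul (1 / (2 * (1 + Real.exp a))))
  · exact sub_nonneg.2 (one_div_le_exp_div_one_add_exp_sq (interior_subset hx))

/-- Strong-convexity lower bound for the pointwise logistic risk
`f_p(q) = p·log(1 + e^{-q}) + (1 - p)·log(1 + e^{q})` on `[-a, a]`. -/
theorem stmt_9 (p : ℝ) (hp : p ∈ Set.Icc (0:ℝ) 1) (a : ℝ) (ha : 0 < a) :
    ∀ q₁ ∈ Set.Icc (-a) a, ∀ q₂ ∈ Set.Icc (-a) a,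
      (p * Real.log (1 + Real.exp (-q₁)) + (1 - p) * Real.log (1 + Real.exp q₁)) -
        (p * Real.log (1 + Real.exp (-q₂)) + (1 - p) * Real.log (1 + Real.exp q₂)) ≥
      (1 / (1 + Real.exp (-q₂)) - p) * (q₁ - q₂) +
        (1 / (4 * (1 + Real.exp a))) * (q₁ - q₂) ^ 2 := by
  intro q₁ h₁ q₂ h₂
  have h := (convexOn_log_one_add_exp_sub_sq a).add_mul_sub_le_of_hasDerivAt h₂ h₁
    ((hasDerivAt_log_one_add_exp q₂).fun_sub
      ((hasDerivAt_pow 2 q₂).const_mul (1 / (4 * (1 + Real.exp a)))))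
  rw [log_one_add_exp_neg q₁, log_one_add_exp_neg q₂]
  norm_num at h ⊢
  linarith
end

section
/- Let (Ω, 𝔽, P) be a probability space, X : Ω → 𝒳 measurable, Y : Ω → {0, 1} a random variable, and a > 0. Let K be a convex set of measurable functions θ : 𝒳 → ℝ with |θ(x)| ≤ a for all x, and define the logistic risk R(θ) = E[Y·log(1 + e^{−θ(X)}) + (1 − Y)·log(1 + e^{θ(X)})]. Suppose θₙ ∈ K satisfies R(θₙ) ≤ R(θ) for all θ ∈ K. Then for every θ ∈ K, R(θ) − R(θₙ) ≥ (1/(4(1 + e^{a})))·E[(θ(X) − θₙ(X))²]. -/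
open MeasureTheory

/-- The softplus function `u ↦ log (1 + e^u)` is `1/(2(1 + e^a))`-strongly convex on `[-a, a]`. -/
theorem strongConvexOn_log_one_add_exp (a : ℝ) :
    StrongConvexOn (Set.Icc (-a) a) (1 / (2 * (1 + Real.exp a)))
      fun u : ℝ => Real.log (1 + Real.exp u) := by
  rw [strongConvexOn_iff_convex]
  set c := 1 / (2 * (1 + Real.exp a)) with hc
  have hpos (u : ℝ) : 0 < 1 + Real.exp u := by positivity
  have hderiv (u : ℝ) : HasDerivAt (fun u : ℝ => Real.log (1 + Real.exp u) - c / 2 * ‖u‖ ^ 2)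
      (Real.exp u / (1 + Real.exp u) - c * u) u := by
    simp only [Real.norm_eq_abs, sq_abs]
    have h := (((Real.hasDerivAt_exp u).const_add 1).log (hpos u).ne').sub
      (((hasDerivAt_id u).pow 2).const_mul (c / 2))
    refine h.congr_deriv ?_
    simp
    ring
  have hderiv2 (u : ℝ) : HasDerivAt (fun u : ℝ => Real.exp u / (1 + Real.exp u) - c * u)
      (Real.exp u / (1 + Real.exp u) ^ 2 - c) u := by
    have h := ((Real.hasDerivAt_exp u).div ((Real.hasDerivAt_exp u).const_add 1) (hpos u).ne').sub
      ((hasDerivAt_id u).const_mul c)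
    refine h.congr_deriv ?_
    simp
    ring
  refine convexOn_of_hasDerivWithinAt2_nonneg (convex_Icc _ _)
    (fun u _ => (hderiv u).continuousAt.continuousWithinAt)
    (fun u _ => (hderiv u).hasDerivWithinAt) (fun u _ => (hderiv2 u).hasDerivWithinAt) ?_
  intro u hu
  obtain ⟨hu₁, hu₂⟩ := interior_subset hu
  have hle : Real.exp u ≤ Real.exp a := Real.exp_le_exp.2 hu₂
  have hone : 1 ≤ Real.exp a * Real.exp u := by
    rw [← Real.exp_add]
    exact Real.one_le_exp (by linarith)
  rw [sub_nonneg, hc, div_le_div_iff₀ (by positivity) (by positivity)]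
  nlinarith [Real.exp_pos u]

/-- The logistic loss is strongly convex in its first argument on `[-a, a]`. -/
theorem strongConvexOn_logisticLoss (a : ℝ) {y : ℝ} (hy : y = 0 ∨ y = 1) :
    StrongConvexOn (Set.Icc (-a) a) (1 / (2 * (1 + Real.exp a)))
      fun u : ℝ => y * Real.log (1 + Real.exp (-u)) + (1 - y) * Real.log (1 + Real.exp u) := by
  have h := strongConvexOn_log_one_add_exp a
  rcases hy with rfl | rfl
  · simpa using h
  · refine ⟨convex_Icc _ _, fun u hu v hv s t hs ht hst => ?_⟩
    have hneg := h.2 (x := -u) (y := -v) ⟨neg_le_neg hu.2, neg_le.1 hu.1⟩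
      ⟨neg_le_neg hv.2, neg_le.1 hv.1⟩ hs ht hst
    rw [smul_neg, smul_neg, ← neg_add, ← neg_sub', norm_neg] at hneg
    simpa using hneg

/-- The logistic loss of a bounded measurable score is integrable. -/
theorem integrable_logisticLoss {Ω : Type*} [MeasurableSpace Ω] {P : Measure Ω}
    [IsFiniteMeasure P] {Y : Ω → ℝ} (hY : Measurable Y) (hY01 : ∀ ω, Y ω = 0 ∨ Y ω = 1)
    {f : Ω → ℝ} (hf : Measurable f) {a : ℝ} (hfa : ∀ ω, |f ω| ≤ a) :
    Integrable (fun ω => Y ω * Real.log (1 + Real.exp (-(f ω))) +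
      (1 - Y ω) * Real.log (1 + Real.exp (f ω))) P := by
  refine Integrable.of_bound (Measurable.aestronglyMeasurable (by fun_prop))
    (Real.log (1 + Real.exp a)) (.of_forall fun ω => ?_)
  have key {u : ℝ} (hu : u ≤ a) : |Real.log (1 + Real.exp u)| ≤ Real.log (1 + Real.exp a) := by
    rw [abs_of_nonneg (Real.log_nonneg (by linarith [Real.exp_pos u]))]
    gcongr
  obtain ⟨h₁, h₂⟩ := abs_le.1 (hfa ω)
  rcases hY01 ω with h | h
  · simpa [h] using key h₂
  · simpa [h] using key (neg_le.1 h₁)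

/-- A bound that holds up to every factor `1 - t` with `t ∈ (0, 1)` holds. -/
theorem le_of_forall_one_sub_mul_le {x y : ℝ}
    (h : ∀ t : ℝ, 0 < t → t < 1 → (1 - t) * x ≤ y) : x ≤ y := by
  have hlim : Filter.Tendsto (fun t : ℝ => (1 - t) * x) (nhdsWithin 0 (Set.Ioi 0)) (nhds x) := by
    have hcont : Continuous fun t : ℝ => (1 - t) * x := by fun_prop
    simpa using (hcont.tendsto 0).mono_left nhdsWithin_le_nhds
  refine le_of_tendsto hlim ?_
  filter_upwards [Ioo_mem_nhdsGT one_pos] with t ht using h t ht.1 ht.2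

/-- The excess logistic risk over a convex class bounded by `a` dominates
`1/(4(1 + e^a))` times the squared `L²(P)` distance to the risk minimizer. -/
theorem stmt_11 {Ω 𝒳 : Type*} [MeasurableSpace Ω] [MeasurableSpace 𝒳]
    (P : Measure Ω) [IsProbabilityMeasure P]
    (X : Ω → 𝒳) (hX : Measurable X) (Y : Ω → ℝ) (hYm : Measurable Y)
    (hY01 : ∀ ω, Y ω = 0 ∨ Y ω = 1)
    (a : ℝ) (ha : 0 < a)
    (K : Set (𝒳 → ℝ)) (hK : Convex ℝ K)
    (hKmeas : ∀ θ ∈ K, Measurable θ) (hKbdd : ∀ θ ∈ K, ∀ x, |θ x| ≤ a)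
    (θₙ : 𝒳 → ℝ) (hθₙ : θₙ ∈ K)
    (hmin : ∀ θ ∈ K,
      (∫ ω, (Y ω * Real.log (1 + Real.exp (-(θₙ (X ω)))) +
          (1 - Y ω) * Real.log (1 + Real.exp (θₙ (X ω)))) ∂P) ≤
        ∫ ω, (Y ω * Real.log (1 + Real.exp (-(θ (X ω)))) +
          (1 - Y ω) * Real.log (1 + Real.exp (θ (X ω)))) ∂P) :
    ∀ θ ∈ K,
      (∫ ω, (Y ω * Real.log (1 + Real.exp (-(θ (X ω)))) +
          (1 - Y ω) * Real.log (1 + Real.exp (θ (X ω)))) ∂P) -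
        (∫ ω, (Y ω * Real.log (1 + Real.exp (-(θₙ (X ω)))) +
          (1 - Y ω) * Real.log (1 + Real.exp (θₙ (X ω)))) ∂P) ≥
      (1 / (4 * (1 + Real.exp a))) * ∫ ω, (θ (X ω) - θₙ (X ω)) ^ 2 ∂P := by
  intro θ hθ
  have hint {η : 𝒳 → ℝ} (hη : η ∈ K) :=
    integrable_logisticLoss (P := P) hYm hY01 ((hKmeas η hη).comp hX) fun ω => hKbdd η hη (X ω)
  have hmθ := hKmeas θ hθ
  have hmθₙ := hKmeas θₙ hθₙ
  have hsq : Integrable (fun ω => (θ (X ω) - θₙ (X ω)) ^ 2) P := by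
    refine Integrable.of_bound (Measurable.aestronglyMeasurable (by fun_prop))
      ((a + a) ^ 2) (.of_forall fun ω => ?_)
    rw [norm_pow]
    gcongr
    exact (norm_sub_le _ _).trans (add_le_add (hKbdd θ hθ _) (hKbdd θₙ hθₙ _))
  refine le_of_forall_one_sub_mul_le fun t ht₀ ht₁ => ?_
  have hmem : t • θ + (1 - t) • θₙ ∈ K :=
    hK hθ hθₙ ht₀.le (sub_nonneg.2 ht₁.le) (by ring)
  have hconv := integral_mono (hint hmem)
    ((((hint hθ).const_mul t).add ((hint hθₙ).const_mul (1 - t))).sub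
      (hsq.const_mul (t * (1 - t) * (1 / (4 * (1 + Real.exp a)))))) fun ω => by
    have h := (strongConvexOn_logisticLoss a (hY01 ω)).2
      (abs_le.1 (hKbdd θ hθ (X ω))) (abs_le.1 (hKbdd θₙ hθₙ (X ω)))
      ht₀.le (sub_nonneg.2 ht₁.le) (by ring)
    refine h.trans_eq ?_
    simp only [Real.norm_eq_abs, sq_abs, smul_eq_mul, Pi.sub_apply, Pi.add_apply,
      Function.comp_apply]
    field_simp
    ring
  rw [integral_sub' (((hint hθ).const_mul t).add ((hint hθₙ).const_mul (1 - t)))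
      (hsq.const_mul _), integral_add' ((hint hθ).const_mul t) ((hint hθₙ).const_mul (1 - t)),
    integral_const_mul, integral_const_mul, integral_const_mul] at hconv
  have hle := (hmin _ hmem).trans hconv
  simp only [Function.comp_apply] at hle
  refine le_of_mul_le_mul_left ?_ ht₀
  linarith
end

section
/- Let (Ω, 𝔽, P) be a probability space, X : Ω → 𝒳 measurable, Y : Ω → {0, 1} a random variable, and a > 0. Let K be a convex set of measurable functions θ : 𝒳 → ℝ with |θ(x)| ≤ a for all x, define the logistic loss of θ as L(θ)(ω) = Y(ω)·log(1 + e^{−θ(X(ω))}) + (1 − Y(ω))·log(1 + e^{θ(X(ω))}) and the risk R(θ) = E[L(θ)]. Suppose θₙ ∈ K satisfies R(θₙ) ≤ R(θ) for all θ ∈ K. Then for every θ ∈ K, E[(L(θ) − L(θₙ))²] ≤ 4(1 + e^{a})·(R(θ) − R(θₙ)). -/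
open MeasureTheory

/-- The loss of predicting `u` for a label `y`. -/
noncomputable def logisticLoss (y u : ℝ) : ℝ :=
  y * Real.log (1 + Real.exp (-u)) + (1 - y) * Real.log (1 + Real.exp u)

theorem exp_eq_exp_half_sq (x : ℝ) : Real.exp x = Real.exp (x / 2) ^ 2 := by
  rw [← Real.exp_nat_mul]; congr 1; push_cast; ring

theorem sq_le_exp_add_exp_neg_sub_two (x : ℝ) : x ^ 2 ≤ Real.exp x + Real.exp (-x) - 2 := by
  have h : |x / 2| ≤ |Real.sinh (x / 2)| := by
    rw [Real.abs_sinh]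
    exact Real.self_le_sinh_iff.2 (abs_nonneg _)
  have h2 := sq_le_sq.2 h
  have hmul : Real.exp (x / 2) * Real.exp (-(x / 2)) = 1 := by rw [← Real.exp_add]; simp
  rw [Real.sinh_eq] at h2
  rw [exp_eq_exp_half_sq x, exp_eq_exp_half_sq (-x), neg_div]
  nlinarith

/-- Midpoint strong convexity of `log (1 + exp u)`, measured in the function's own increments. -/
theorem sq_log_one_add_exp_sub_le {a u v : ℝ} (hu : u ≤ a) (hv : v ≤ a) :
    (Real.log (1 + Real.exp u) - Real.log (1 + Real.exp v)) ^ 2 ≤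
      4 * (1 + Real.exp a) * (Real.log (1 + Real.exp u) + Real.log (1 + Real.exp v) -
        2 * Real.log (1 + Real.exp ((u + v) / 2))) := by
  have hpa : Real.exp (u / 2) ≤ Real.exp (a / 2) := Real.exp_le_exp.2 (by linarith)
  have hqa : Real.exp (v / 2) ≤ Real.exp (a / 2) := Real.exp_le_exp.2 (by linarith)
  have hm : Real.exp ((u + v) / 2) = Real.exp (u / 2) * Real.exp (v / 2) := by
    rw [← Real.exp_add]; congr 1; ring
  rw [hm, exp_eq_exp_half_sq u, exp_eq_exp_half_sq v, exp_eq_exp_half_sq a]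
  have hp := Real.exp_pos (u / 2)
  have hq := Real.exp_pos (v / 2)
  generalize Real.exp (u / 2) = p at *
  generalize Real.exp (v / 2) = q at *
  generalize Real.exp (a / 2) = b at *
  have hP : 0 < 1 + p ^ 2 := by positivity
  have hQ : 0 < 1 + q ^ 2 := by positivity
  have hM : 0 < 1 + p * q := by positivity
  have hlow : (p - q) ^ 2 / ((1 + p ^ 2) * (1 + q ^ 2)) ≤
      Real.log (1 + p ^ 2) + Real.log (1 + q ^ 2) - 2 * Real.log (1 + p * q) := by
    have h := Real.one_sub_inv_le_log_of_pos
      (x := (1 + p ^ 2) * (1 + q ^ 2) / (1 + p * q) ^ 2) (by positivity)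
    rw [Real.log_div (by positivity) (by positivity), Real.log_mul hP.ne' hQ.ne',
      Real.log_pow] at h
    push_cast at h
    refine le_trans (le_of_eq ?_) h
    field_simp
    ring
  have hup : (Real.log (1 + p ^ 2) - Real.log (1 + q ^ 2)) ^ 2 ≤
      (p + q) ^ 2 * ((p - q) ^ 2 / ((1 + p ^ 2) * (1 + q ^ 2))) := by
    have h := sq_le_exp_add_exp_neg_sub_two (Real.log (1 + p ^ 2) - Real.log (1 + q ^ 2))
    rw [neg_sub, Real.exp_sub, Real.exp_sub, Real.exp_log hP, Real.exp_log hQ] at h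
    refine h.trans (le_of_eq ?_)
    field_simp
    ring
  have hsum : (p + q) ^ 2 ≤ 4 * (1 + b ^ 2) := by nlinarith
  exact hup.trans (mul_le_mul hsum hlow (by positivity) (by positivity))

theorem sq_logisticLoss_sub_le {a u v y : ℝ} (hy : y = 0 ∨ y = 1) (hu : |u| ≤ a) (hv : |v| ≤ a) :
    (logisticLoss y u - logisticLoss y v) ^ 2 ≤ 4 * (1 + Real.exp a) *
      (logisticLoss y u + logisticLoss y v - 2 * logisticLoss y ((u + v) / 2)) := by
  obtain ⟨hu1, hu2⟩ := abs_le.1 hu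
  obtain ⟨hv1, hv2⟩ := abs_le.1 hv
  rcases hy with rfl | rfl
  · simpa [logisticLoss] using sq_log_one_add_exp_sub_le hu2 hv2
  · have h := sq_log_one_add_exp_sub_le (neg_le.1 hu1) (neg_le.1 hv1)
    rw [show (-u + -v) / 2 = -((u + v) / 2) by ring] at h
    simpa [logisticLoss] using h

theorem abs_logisticLoss_le {a u y : ℝ} (hy : y = 0 ∨ y = 1) (hu : |u| ≤ a) :
    |logisticLoss y u| ≤ Real.log (1 + Real.exp a) := by
  have bound {w : ℝ} (hw : w ≤ a) :
      |Real.log (1 + Real.exp w)| ≤ Real.log (1 + Real.exp a) := by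
    have hpos := Real.exp_pos w
    rw [abs_of_nonneg (Real.log_nonneg (by linarith))]
    gcongr
  rcases hy with rfl | rfl
  · simpa [logisticLoss] using bound (abs_le.1 hu).2
  · simpa [logisticLoss] using bound (neg_le.1 (abs_le.1 hu).1)

theorem measurable_logisticLoss : Measurable (Function.uncurry logisticLoss) := by
  unfold logisticLoss Function.uncurry
  fun_prop

/-- For logistic regression over a convex class bounded by `a`, the squared `L²(P)`
norm of the loss difference `L(θ) - L(θₙ)` is at most `4(1 + e^a)` times the excess
risk of `θ` over the risk minimizer `θₙ`. -/
theorem stmt_12 {Ω 𝒳 : Type*} [MeasurableSpace Ω] [MeasurableSpace 𝒳]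
    (P : Measure Ω) [IsProbabilityMeasure P]
    (X : Ω → 𝒳) (hX : Measurable X) (Y : Ω → ℝ) (hYm : Measurable Y)
    (hY01 : ∀ ω, Y ω = 0 ∨ Y ω = 1)
    (a : ℝ) (ha : 0 < a)
    (K : Set (𝒳 → ℝ)) (hK : Convex ℝ K)
    (hKmeas : ∀ θ ∈ K, Measurable θ) (hKbdd : ∀ θ ∈ K, ∀ x, |θ x| ≤ a)
    (θₙ : 𝒳 → ℝ) (hθₙ : θₙ ∈ K)
    (hmin : ∀ θ ∈ K,
      (∫ ω, (Y ω * Real.log (1 + Real.exp (-(θₙ (X ω)))) +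
          (1 - Y ω) * Real.log (1 + Real.exp (θₙ (X ω)))) ∂P) ≤
        ∫ ω, (Y ω * Real.log (1 + Real.exp (-(θ (X ω)))) +
          (1 - Y ω) * Real.log (1 + Real.exp (θ (X ω)))) ∂P) :
    ∀ θ ∈ K,
      (∫ ω, ((Y ω * Real.log (1 + Real.exp (-(θ (X ω)))) +
            (1 - Y ω) * Real.log (1 + Real.exp (θ (X ω)))) -
          (Y ω * Real.log (1 + Real.exp (-(θₙ (X ω)))) +
            (1 - Y ω) * Real.log (1 + Real.exp (θₙ (X ω))))) ^ 2 ∂P) ≤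
        4 * (1 + Real.exp a) *
          ((∫ ω, (Y ω * Real.log (1 + Real.exp (-(θ (X ω)))) +
              (1 - Y ω) * Real.log (1 + Real.exp (θ (X ω)))) ∂P) -
            ∫ ω, (Y ω * Real.log (1 + Real.exp (-(θₙ (X ω)))) +
              (1 - Y ω) * Real.log (1 + Real.exp (θₙ (X ω)))) ∂P) := by
  intro θ hθ
  change ∫ ω, (logisticLoss (Y ω) (θ (X ω)) - logisticLoss (Y ω) (θₙ (X ω))) ^ 2 ∂P ≤
    4 * (1 + Real.exp a) * ((∫ ω, logisticLoss (Y ω) (θ (X ω)) ∂P) -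
      ∫ ω, logisticLoss (Y ω) (θₙ (X ω)) ∂P)
  have meas {η : 𝒳 → ℝ} (hη : η ∈ K) : Measurable fun ω => logisticLoss (Y ω) (η (X ω)) :=
    measurable_logisticLoss.comp (hYm.prodMk ((hKmeas η hη).comp hX))
  have integ {η : 𝒳 → ℝ} (hη : η ∈ K) : Integrable (fun ω => logisticLoss (Y ω) (η (X ω))) P :=
    Integrable.of_bound (meas hη).aestronglyMeasurable (Real.log (1 + Real.exp a))
      (ae_of_all _ fun ω => abs_logisticLoss_le (hY01 ω) (hKbdd η hη _))
  have hmid : (fun x => (θ x + θₙ x) / 2) ∈ K := by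
    convert hK hθ hθₙ (show (0 : ℝ) ≤ 1 / 2 by norm_num) (show (0 : ℝ) ≤ 1 / 2 by norm_num)
      (by norm_num) using 1
    ext x
    simp only [Pi.add_apply, Pi.smul_apply, smul_eq_mul]
    ring
  have hrisk : ∫ ω, logisticLoss (Y ω) (θₙ (X ω)) ∂P ≤
      ∫ ω, logisticLoss (Y ω) ((θ (X ω) + θₙ (X ω)) / 2) ∂P := hmin _ hmid
  have hsum : Integrable (fun ω => logisticLoss (Y ω) (θ (X ω)) +
      logisticLoss (Y ω) (θₙ (X ω))) P := (integ hθ).add (integ hθₙ)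
  have hgap := hsum.sub ((integ hmid).const_mul 2)
  calc
    _ ≤ ∫ ω, 4 * (1 + Real.exp a) * (logisticLoss (Y ω) (θ (X ω)) +
          logisticLoss (Y ω) (θₙ (X ω)) -
            2 * logisticLoss (Y ω) ((θ (X ω) + θₙ (X ω)) / 2)) ∂P :=
      integral_mono_of_nonneg (ae_of_all _ fun ω => sq_nonneg _) (hgap.const_mul _)
        (ae_of_all _ fun ω =>
          sq_logisticLoss_sub_le (hY01 ω) (hKbdd θ hθ _) (hKbdd θₙ hθₙ _))
    _ = 4 * (1 + Real.exp a) * ((∫ ω, logisticLoss (Y ω) (θ (X ω)) ∂P) +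
          (∫ ω, logisticLoss (Y ω) (θₙ (X ω)) ∂P) -
            2 * ∫ ω, logisticLoss (Y ω) ((θ (X ω) + θₙ (X ω)) / 2) ∂P) := by
      rw [integral_const_mul, integral_sub hsum ((integ hmid).const_mul 2),
        integral_const_mul, ← integral_add (integ hθ) (integ hθₙ)]
    _ ≤ _ := mul_le_mul_of_nonneg_left (by linarith) (by positivity)
end
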